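/- Let k ≥ 2, n ≥ 1, and let R be an associative ring with 1 in which n·1 is invertible (the paper assumes 1/2 ∈ R; the invoked right Cayley–Hamilton theorem for index 2 requires 1/n ∈ R), and suppose R is Lie nilpotent of index k. Let A be an n×n matrix over R, let D = R[[R,R],R]R, and let Ā be the image of A in Mₙ(R/D). Then for every choice of elements λ₀^{(2)}, λ₁^{(2)}, …, λ_{n²}^{(2)} ∈ R whose images in R/D are the corresponding coefficients of the second right characteristic polynomial p_{Ā,2}(x) = rdet_{(2)}(x·Iₙ − Ā) ∈ (R/D)[x] (in particular λ_{n²}^{(2)} may be taken to be n·((n−1)!)^{1+n}), the power Cayley–Hamilton identity ( Iₙ·λ₀^{(2)} + A·λ₁^{(2)} + ⋯ + A^{n²−1}·λ_{n²−1}^{(2)} + A^{n²}·λ_{n²}^{(2)} )^{2^{k−2}} = 0 holds, where A^i·λ denotes the product of A^i with the scalar matrix λ·Iₙ. -/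

import Mathlib

/-- `lnc a [x₁,…,x_m]` is the left-normed commutator `[…[[a,x₁],x₂],…,x_m]`,
where `[a,b] = a*b - b*a`. -/
def lnc {R : Type*} [Ring R] : R → List R → R
  | a, [] => a
  | a, x :: l => lnc (a * x - x * a) l

/-- `LNC k x` is the left-normed commutator `[x 0, x 1, …, x k]` of the `k+1`
elements `x 0, …, x k`. -/
def LNC {R : Type*} [Ring R] (k : ℕ) (x : ℕ → R) : R :=
  lnc (x 0) ((List.range k).map fun i => x (i + 1))

/-- A ring `R` is Lie nilpotent of index `k` if all left-normed commutators of
any `k+1` of its elements vanish. -/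
def LieNilpotentOfIndex (R : Type*) [Ring R] (k : ℕ) : Prop :=
  ∀ x : ℕ → R, LNC k x = 0

/-- The symmetric determinant. -/
def sdet {R : Type*} [Ring R] {n : ℕ} (A : Matrix (Fin n) (Fin n) R) : R :=
  ∑ α : Equiv.Perm (Fin n), ∑ β : Equiv.Perm (Fin n),
    ((Equiv.Perm.sign α * Equiv.Perm.sign β : ℤˣ) : ℤ) •
      (List.ofFn fun i => A (α i) (β i)).prod

/-- The symmetric adjoint. -/
def sadj {R : Type*} [Ring R] {n : ℕ} (A : Matrix (Fin (n + 1)) (Fin (n + 1)) R) :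
    Matrix (Fin (n + 1)) (Fin (n + 1)) R :=
  fun r s => (-1 : R) ^ ((r : ℕ) + (s : ℕ)) * sdet (A.submatrix s.succAbove r.succAbove)

/-- `adjAux A j = (P_j, P₁ * ⋯ * P_j)` where `(P_j)` is the right adjoint sequence of `A`. -/
def adjAux {R : Type*} [Ring R] {n : ℕ} (A : Matrix (Fin (n + 1)) (Fin (n + 1)) R) :
    ℕ → Matrix (Fin (n + 1)) (Fin (n + 1)) R × Matrix (Fin (n + 1)) (Fin (n + 1)) R
  | 0 => (1, 1)
  | j + 1 =>
      let q := adjAux A j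
      let p := sadj (A * q.2)
      (p, q.2 * p)

/-- The product `P₁ * ⋯ * P_k` of the right adjoint sequence of `A`. -/
def radjProd {R : Type*} [Ring R] {n : ℕ} (A : Matrix (Fin (n + 1)) (Fin (n + 1)) R)
    (k : ℕ) : Matrix (Fin (n + 1)) (Fin (n + 1)) R :=
  (adjAux A k).2

/-- The `k`-th right adjoint `radj_{(k)}(A) = n • (P₁ * ⋯ * P_k)`. -/
def radj {R : Type*} [Ring R] {n : ℕ} (A : Matrix (Fin (n + 1)) (Fin (n + 1)) R)
    (k : ℕ) : Matrix (Fin (n + 1)) (Fin (n + 1)) R :=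
  (n + 1) • radjProd A k

/-- The `k`-th right determinant `rdet_{(k)}(A) = tr (A * P₁ * ⋯ * P_k)`. -/
def rdet {R : Type*} [Ring R] {n : ℕ} (A : Matrix (Fin (n + 1)) (Fin (n + 1)) R)
    (k : ℕ) : R :=
  (A * radjProd A k).trace

/-- The `k`-th right characteristic polynomial `p_{A,k}(x) = rdet_{(k)}(x Iₙ - A)`. -/
noncomputable def rcharpoly {R : Type*} [Ring R] {n : ℕ}
    (A : Matrix (Fin (n + 1)) (Fin (n + 1)) R) (k : ℕ) : Polynomial R :=
  rdet ((Polynomial.X : Polynomial R) • (1 : Matrix (Fin (n + 1)) (Fin (n + 1)) (Polynomial R))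
    - A.map Polynomial.C) k

section Commutators

variable {R : Type*} [Ring R]

theorem lnc_append_singleton (a y : R) (l : List R) :
    lnc a (l ++ [y]) = lnc a l * y - y * lnc a l := by
  induction l generalizing a with
  | nil => rfl
  | cons x l ih => exact ih _

theorem LNC_succ (k : ℕ) (x : ℕ → R) :
    LNC (k + 1) x = LNC k x * x (k + 1) - x (k + 1) * LNC k x := by
  simp [LNC, List.range_succ, lnc_append_singleton]

theorem LNC_congr {k : ℕ} {x y : ℕ → R} (h : ∀ i ≤ k, x i = y i) : LNC k x = LNC k y := by
  induction k with
  | zero => exact h 0 le_rfl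
  | succ k ih => rw [LNC_succ, LNC_succ, ih fun i hi => h i (by omega), h (k + 1) le_rfl]

/-- The left-normed commutators of `k + 1` elements of `R`. -/
def lieCommutators (R : Type*) [Ring R] : ℕ → Set R
  | 0 => Set.univ
  | k + 1 => {u | ∃ p ∈ lieCommutators R k, ∃ c, u = p * c - c * p}

theorem exists_eq_LNC_of_mem_lieCommutators {k : ℕ} {u : R} (hu : u ∈ lieCommutators R k) :
    ∃ x : ℕ → R, u = LNC k x := by
  induction k generalizing u with
  | zero => exact ⟨fun _ => u, rfl⟩
  | succ k ih =>
    obtain ⟨p, hp, c, rfl⟩ := hu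
    obtain ⟨x, rfl⟩ := ih hp
    refine ⟨Function.update x (k + 1) c, ?_⟩
    rw [LNC_succ, Function.update_self,
      LNC_congr (x := Function.update x (k + 1) c) (y := x)
        fun i hi => Function.update_of_ne (by omega) _ _]

theorem commutator_mul_mem_span {m : ℕ} {u w : R} (hu : u ∈ lieCommutators R (m + 1))
    (hw : w ∈ lieCommutators R 2) :
    u * w ∈ TwoSidedIdeal.span (lieCommutators R (m + 2)) := by
  obtain ⟨p, hp, c, rfl⟩ := hu
  obtain ⟨_, ⟨d, -, e, rfl⟩, f, rfl⟩ := hw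
  have mem : ∀ x y : R, (p * x - x * p) * y - y * (p * x - x * p) ∈
      TwoSidedIdeal.span (lieCommutators R (m + 2)) := fun x y =>
    TwoSidedIdeal.subset_span ⟨_, ⟨p, hp, x, rfl⟩, y, rfl⟩
  set I := TwoSidedIdeal.span (lieCommutators R (m + 2))
  set v := d * e - e * d with hv
  have hpv : p * v - v * p ∈ I := by
    have := I.sub_mem (mem d e) (mem e d)
    convert this using 1
    rw [hv]; noncomm_ring
  have key : (p * c - c * p) * (v * f - f * v) =
      ((p * (c * v) - (c * v) * p) * f - f * (p * (c * v) - (c * v) * p))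
      - ((p * c - c * p) * f - f * (p * c - c * p)) * v
      - (c * f - f * c) * (p * v - v * p)
      - c * ((p * v - v * p) * f - f * (p * v - v * p)) := by
    noncomm_ring
  rw [key]
  exact I.sub_mem (I.sub_mem (I.sub_mem (mem _ _) (I.mul_mem_right _ _ (mem _ _)))
    (I.mul_mem_left _ _ hpv)) (I.mul_mem_left _ _ (mem _ _))

theorem mul_mem_span_lieCommutators {m : ℕ} {x y : R}
    (hx : x ∈ TwoSidedIdeal.span (lieCommutators R (m + 1)))
    (hy : y ∈ TwoSidedIdeal.span (lieCommutators R 2)) :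
    x * y ∈ TwoSidedIdeal.span (lieCommutators R (m + 2)) := by
  have gen : ∀ u ∈ lieCommutators R (m + 1), ∀ y ∈ TwoSidedIdeal.span (lieCommutators R 2),
      u * y ∈ TwoSidedIdeal.span (lieCommutators R (m + 2)) := by
    intro u hu y hy
    have central : ∀ r, u * r - r * u ∈ TwoSidedIdeal.span (lieCommutators R (m + 2)) :=
      fun r => TwoSidedIdeal.subset_span ⟨u, hu, r, rfl⟩
    induction hy using TwoSidedIdeal.span_induction with
    | mem w hw => exact commutator_mul_mem_span hu hw
    | zero => simp
    | add a b _ _ ha hb => simpa [mul_add] using TwoSidedIdeal.add_mem _ ha hb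
    | neg a _ ha => simpa using TwoSidedIdeal.neg_mem _ ha
    | left_absorb r a _ ha =>
      have := TwoSidedIdeal.add_mem _ (TwoSidedIdeal.mul_mem_left _ r _ ha)
        (TwoSidedIdeal.mul_mem_right _ _ a (central r))
      convert this using 1
      noncomm_ring
    | right_absorb r a _ ha =>
      rw [← mul_assoc]
      exact TwoSidedIdeal.mul_mem_right _ _ _ ha
  induction hx using TwoSidedIdeal.span_induction generalizing y with
  | mem u hu => exact gen u hu y hy
  | zero => simp
  | add a b _ _ ha hb => simpa [add_mul] using TwoSidedIdeal.add_mem _ (ha hy) (hb hy)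
  | neg a _ ha => simpa using TwoSidedIdeal.neg_mem _ (ha hy)
  | left_absorb r a _ ha =>
    rw [mul_assoc]
    exact TwoSidedIdeal.mul_mem_left _ _ _ (ha hy)
  | right_absorb r a _ ha =>
    rw [mul_assoc]
    exact ha (TwoSidedIdeal.mul_mem_left _ _ _ hy)

theorem pow_apply_mem_span_lieCommutators {ι : Type*} [Fintype ι] [DecidableEq ι]
    {M : Matrix ι ι R} (hM : ∀ i j, M i j ∈ TwoSidedIdeal.span (lieCommutators R 2))
    (m : ℕ) (i j : ι) :
    (M ^ (m + 1)) i j ∈ TwoSidedIdeal.span (lieCommutators R (m + 2)) := by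
  induction m generalizing i j with
  | zero => simpa using hM i j
  | succ m ih =>
    rw [pow_succ, Matrix.mul_apply]
    exact sum_mem fun q _ => mul_mem_span_lieCommutators (ih i q) (hM q j)

theorem pow_eq_zero_of_lieNilpotent {ι : Type*} [Fintype ι] [DecidableEq ι]
    {k : ℕ} (hk : 2 ≤ k) (hL : LieNilpotentOfIndex R k)
    {M : Matrix ι ι R} (hM : ∀ i j, M i j ∈ TwoSidedIdeal.span (lieCommutators R 2)) :
    M ^ (k - 1) = 0 := by
  obtain ⟨m, rfl⟩ := Nat.exists_eq_add_of_le' hk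
  have hspan : TwoSidedIdeal.span (lieCommutators R (m + 2)) ≤ ⊥ := by
    refine TwoSidedIdeal.span_le.2 fun u hu => ?_
    obtain ⟨x, rfl⟩ := exists_eq_LNC_of_mem_lieCommutators hu
    rw [hL x]
    exact TwoSidedIdeal.zero_mem _
  ext i j
  exact (TwoSidedIdeal.mem_bot _).1 (hspan (pow_apply_mem_span_lieCommutators hM m i j))

end Commutators

section SymmetricDeterminant

open Equiv

variable {R : Type*} [Ring R] {n : ℕ}

/-- The signed word indexed by `(α, β)` in the expansion of `sdet A`. -/
def sdetTerm (A : Matrix (Fin n) (Fin n) R) (α β : Perm (Fin n)) : R :=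
  ((Perm.sign α * Perm.sign β : ℤˣ) : ℤ) • (List.ofFn fun i => A (α i) (β i)).prod

theorem sdet_eq_sum_sdetTerm (A : Matrix (Fin n) (Fin n) R) :
    sdet A = ∑ α, ∑ β, sdetTerm A α β := rfl

theorem sdet_eq_zero_of_row_eq {A : Matrix (Fin n) (Fin n) R} {r s : Fin n} (hrs : r ≠ s)
    (h : A r = A s) : sdet A = 0 := by
  classical
  rw [sdet_eq_sum_sdetTerm, Finset.sum_comm]
  refine Finset.sum_eq_zero fun β _ => ?_
  have hswap : ∀ i, A (swap r s i) = A i := by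
    intro i
    rcases eq_or_ne i r with rfl | hr
    · simp [h]
    · rcases eq_or_ne i s with rfl | hs
      · simp [h]
      · rw [swap_apply_of_ne_of_ne hr hs]
  refine Finset.sum_involution (fun α _ => swap r s * α) (fun α _ => ?_) (fun α _ _ => ?_)
    (fun _ _ => Finset.mem_univ _) (fun α _ => by simp)
  · simp [sdetTerm, hswap, Perm.sign_swap hrs]
  · simpa [swap_eq_one_iff] using hrs

theorem sum_perm_ite_apply_zero {M : Type*} [AddCommMonoid M] (s : Fin (n + 1))
    (G : Perm (Fin (n + 1)) → M) :
    ∑ α, (if α 0 = s then G α else 0) =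
      ∑ e : Perm (Fin n), G (s.cycleRange.symm * Perm.decomposeFin.symm (0, e)) := by
  rw [← Equiv.sum_comp (Equiv.mulLeft (s.cycleRange.symm : Perm (Fin (n + 1)))),
    ← Equiv.sum_comp Perm.decomposeFin.symm, Fintype.sum_prod_type, Finset.sum_eq_single 0]
  · simp
  · intro p _ hp
    refine Finset.sum_eq_zero fun e _ => if_neg fun h => hp ?_
    simpa [Equiv.symm_apply_eq] using h
  · simp

theorem sum_perm_eq_sum_fin_sum {M : Type*} [AddCommMonoid M] (G : Perm (Fin (n + 1)) → M) :
    ∑ β, G β =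
      ∑ q : Fin (n + 1), ∑ e : Perm (Fin n),
        G (q.cycleRange.symm * Perm.decomposeFin.symm (0, e)) := by
  simp_rw [← sum_perm_ite_apply_zero]
  rw [Finset.sum_comm]
  simp

theorem mul_sadj_apply_self (A : Matrix (Fin (n + 1)) (Fin (n + 1)) R) (s : Fin (n + 1)) :
    (A * sadj A) s s = ∑ α, if α 0 = s then ∑ β, sdetTerm A α β else 0 := by
  rw [sum_perm_ite_apply_zero, Matrix.mul_apply]
  simp_rw [sum_perm_eq_sum_fin_sum]
  rw [Finset.sum_comm]
  refine Finset.sum_congr rfl fun q _ => ?_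
  simp only [sadj, sdet, Finset.mul_sum]
  refine Finset.sum_congr rfl fun α _ => Finset.sum_congr rfl fun β _ => ?_
  simp only [sdetTerm, Perm.sign_mul, Perm.sign_symm, Fin.sign_cycleRange,
    Perm.decomposeFin.symm_sign, if_true, one_mul, List.ofFn_succ, List.prod_cons,
    Perm.mul_apply, Perm.decomposeFin_symm_apply_zero, Perm.decomposeFin_symm_apply_succ,
    Fin.cycleRange_symm_zero, Fin.cycleRange_symm_succ, swap_self, Equiv.refl_apply,
    Matrix.submatrix_apply]
  rw [show (-1 : ℤˣ) ^ (s : ℕ) * Perm.sign α * ((-1) ^ (q : ℕ) * Perm.sign β) =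
    (-1) ^ ((q : ℕ) + s) * (Perm.sign α * Perm.sign β) by
      rw [pow_add]; ac_rfl]
  rcases Nat.even_or_odd ((q : ℕ) + s) with h | h <;>
    rcases Int.units_eq_one_or (Perm.sign α * Perm.sign β) with h' | h' <;>
    simp [h.neg_one_pow, h']

theorem map_prod_ofFn_comp_finRotate {M : Type*} (f : R → M) (g : Fin n → R)
    (hf : ∀ i, ∀ l : List R, l ⊆ List.ofFn g → f (g i * l.prod) = f (l.prod * g i)) :
    f (List.ofFn (g ∘ finRotate n)).prod = f (List.ofFn g).prod := by
  cases n with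
  | zero => rfl
  | succ n =>
    rw [List.ofFn_succ', List.ofFn_succ]
    simp only [List.concat_eq_append, List.prod_append, List.prod_cons, List.prod_nil, mul_one,
      Function.comp_apply, finRotate_apply, Fin.coeSucc_eq_succ, Fin.last_add_one]
    refine (hf 0 _ fun x hx => ?_).symm
    simp only [List.mem_ofFn] at hx ⊢
    obtain ⟨i, rfl⟩ := hx
    exact ⟨_, rfl⟩

theorem map_sdetTerm_mul_finRotate_pow {M : Type*} [AddCommGroup M] (f : R →+ M) {S : Set R}
    (hf : ∀ a ∈ S, ∀ l : List R, (∀ x ∈ l, x ∈ S) → f (a * l.prod) = f (l.prod * a))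
    {A : Matrix (Fin n) (Fin n) R} (hA : ∀ i j, A i j ∈ S) (α β : Perm (Fin n)) (j : ℕ) :
    f (sdetTerm A (α * finRotate n ^ j) (β * finRotate n ^ j)) = f (sdetTerm A α β) := by
  induction j with
  | zero => simp
  | succ j ih =>
    rw [← ih, pow_succ, ← mul_assoc, ← mul_assoc]
    generalize α * finRotate n ^ j = α'
    generalize β * finRotate n ^ j = β'
    have hsign : Perm.sign (α' * finRotate n) * Perm.sign (β' * finRotate n) =
        Perm.sign α' * Perm.sign β' := by
      rw [Perm.sign_mul, Perm.sign_mul, mul_mul_mul_comm, Int.units_mul_self, mul_one]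
    rw [sdetTerm, sdetTerm, hsign, map_zsmul, map_zsmul]
    congr 1
    refine map_prod_ofFn_comp_finRotate f (fun i => A (α' i) (β' i)) fun i l hl =>
      hf _ (hA _ _) l fun x hx => ?_
    obtain ⟨i, rfl⟩ := List.mem_ofFn.1 (hl hx)
    exact hA _ _

theorem nsmul_map_mul_sadj_apply_self {M : Type*} [AddCommGroup M] (f : R →+ M) {S : Set R}
    (hf : ∀ a ∈ S, ∀ l : List R, (∀ x ∈ l, x ∈ S) → f (a * l.prod) = f (l.prod * a))
    {A : Matrix (Fin (n + 1)) (Fin (n + 1)) R} (hA : ∀ i j, A i j ∈ S) (s : Fin (n + 1)) :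
    (n + 1) • f ((A * sadj A) s s) = f (sdet A) := by
  have rotate : ∀ j : Fin (n + 1),
      ∑ α : Perm (Fin (n + 1)), (if α j = s then ∑ β, f (sdetTerm A α β) else 0) =
        f ((A * sadj A) s s) := by
    intro j
    have hj : (finRotate (n + 1) ^ (j : ℕ)) 0 = j := by
      induction j using Fin.induction with
      | zero => simp
      | succ i ih =>
        rw [Fin.val_castSucc] at ih
        rw [Fin.val_succ, pow_succ', Perm.mul_apply, ih, finRotate_apply, Fin.coeSucc_eq_succ]
    set ρ := finRotate (n + 1) ^ (j : ℕ)
    rw [mul_sadj_apply_self, map_sum, ← Equiv.sum_comp (Equiv.mulRight ρ)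
        fun α => f (if α 0 = s then ∑ β, sdetTerm A α β else 0)]
    refine Finset.sum_congr rfl fun α _ => ?_
    simp only [Equiv.coe_mulRight, Perm.mul_apply, hj]
    split_ifs
    · rw [map_sum, ← Equiv.sum_comp (Equiv.mulRight ρ) fun β => f (sdetTerm A (α * ρ) β)]
      exact Finset.sum_congr rfl fun β _ =>
        (map_sdetTerm_mul_finRotate_pow f hf hA α β j).symm
    · simp
  calc (n + 1) • f ((A * sadj A) s s)
      = ∑ j : Fin (n + 1), ∑ α : Perm (Fin (n + 1)),
          (if α j = s then ∑ β, f (sdetTerm A α β) else 0) := by simp [rotate]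
    _ = f (sdet A) := by
      rw [Finset.sum_comm, sdet_eq_sum_sdetTerm, map_sum]
      refine Finset.sum_congr rfl fun α _ => ?_
      rw [← Equiv.sum_comp α.symm]
      simp

theorem nsmul_map_mul_sadj_apply {M : Type*} [AddCommGroup M] (f : R →+ M) {S : Set R}
    (hf : ∀ a ∈ S, ∀ l : List R, (∀ x ∈ l, x ∈ S) → f (a * l.prod) = f (l.prod * a))
    {A : Matrix (Fin (n + 1)) (Fin (n + 1)) R} (hA : ∀ i j, A i j ∈ S) (r s : Fin (n + 1)) :
    (n + 1) • f ((A * sadj A) r s) = f ((sdet A • (1 : Matrix _ _ R)) r s) := by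
  rcases eq_or_ne r s with rfl | hrs
  · simpa using nsmul_map_mul_sadj_apply_self f hf hA r
  · have hrow : (A * sadj A) r s =
        (A.updateRow s (A r) * sadj (A.updateRow s (A r))) s s := by
      simp [Matrix.mul_apply, sadj, Matrix.submatrix]
    have hupd : ∀ i j, A.updateRow s (A r) i j ∈ S := by
      intro i j
      rw [Matrix.updateRow_apply]
      split_ifs <;> apply hA
    rw [hrow, nsmul_map_mul_sadj_apply_self f hf hupd,
      sdet_eq_zero_of_row_eq hrs (by simp [Matrix.updateRow_ne hrs])]
    simp [hrs]

theorem nsmul_mul_sadj_of_commute {A : Matrix (Fin (n + 1)) (Fin (n + 1)) R}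
    (hA : ∀ i j k l, Commute (A i j) (A k l)) :
    (n + 1) • (A * sadj A) = sdet A • (1 : Matrix _ _ R) := by
  ext r s
  refine nsmul_map_mul_sadj_apply (AddMonoidHom.id R) (S := {x | ∃ i j, x = A i j})
    ?_ (fun i j => ⟨i, j, rfl⟩) r s
  rintro _ ⟨i, j, rfl⟩ l hl
  refine Commute.list_prod_right _ _ fun x hx => ?_
  obtain ⟨k, m, rfl⟩ := hl x hx
  exact hA _ _ _ _

theorem commute_mul_sadj (hR : ∀ a b c : R, Commute (a * b - b * a) c)
    (hn : IsUnit ((n + 1 : ℕ) : R)) (A : Matrix (Fin (n + 1)) (Fin (n + 1)) R)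
    (i j k l : Fin (n + 1)) :
    Commute ((A * sadj A) i j) ((A * sadj A) k l) := by
  let Z := (Subring.center R).toAddSubgroup
  have hcentral : ∀ r s, ∃ z ∈ Z, (n + 1) • (A * sadj A) r s =
      (sdet A • (1 : Matrix _ _ R)) r s + z := by
    intro r s
    have h := nsmul_map_mul_sadj_apply (QuotientAddGroup.mk' Z) (S := Set.univ)
      (fun a _ l _ => (QuotientAddGroup.eq_iff_sub_mem).2
        (Subring.mem_center_iff.2 fun c => (hR a l.prod c).eq.symm))
      (A := A) (fun _ _ => Set.mem_univ _) r s
    rw [← map_nsmul] at h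
    exact ⟨_, (QuotientAddGroup.eq_iff_sub_mem).1 h, by abel⟩
  have hscaled : Commute ((n + 1) • (A * sadj A) i j) ((n + 1) • (A * sadj A) k l) := by
    obtain ⟨z, hz, h⟩ := hcentral i j
    obtain ⟨w, hw, h'⟩ := hcentral k l
    have hz' : ∀ x, Commute z x := fun x => (Subring.mem_center_iff.1 hz x).symm
    have hw' : ∀ x, Commute x w := fun x => Subring.mem_center_iff.1 hw x
    rw [h, h']
    refine .add_left (.add_right ?_ (hw' _)) (hz' _)
    simp only [Matrix.smul_apply, Matrix.one_apply]
    split_ifs <;> simp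
  rw [nsmul_eq_mul, nsmul_eq_mul] at hscaled
  set c : R := ((n + 1 : ℕ) : R)
  have hc : ∀ x y : R, c * x * (c * y) = c * c * (x * y) := fun x y => by
    rw [mul_assoc, (Nat.cast_commute (n + 1) x).symm.left_comm y, mul_assoc]
  refine (hn.mul hn).mul_left_cancel ?_
  rw [← hc, ← hc]
  exact hscaled.eq

theorem nsmul_mul_radjProd_two (hR : ∀ a b c : R, Commute (a * b - b * a) c)
    (hn : IsUnit ((n + 1 : ℕ) : R)) (A : Matrix (Fin (n + 1)) (Fin (n + 1)) R) :
    (n + 1) • (A * radjProd A 2) = rdet A 2 • (1 : Matrix _ _ R) := by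
  have hprod : A * radjProd A 2 = (A * sadj A) * sadj (A * sadj A) := by
    simp [radjProd, adjAux, mul_assoc]
  have h := nsmul_mul_sadj_of_commute (commute_mul_sadj hR hn A)
  have htrace : rdet A 2 = sdet (A * sadj A) := by
    have htr := congrArg Matrix.trace h
    rw [Matrix.trace_smul, Matrix.trace_smul, Matrix.trace_one, Fintype.card_fin, ← hprod,
      nsmul_eq_mul, smul_eq_mul, ← Nat.cast_comm] at htr
    exact hn.mul_left_cancel htr
  rw [htrace, hprod, h]

end SymmetricDeterminant

section CharacteristicPolynomial

open Polynomial

variable {S : Type*} [Ring S] {n : ℕ}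

theorem Polynomial.commute_commutator (hS : ∀ a b c : S, Commute (a * b - b * a) c)
    (p q r : S[X]) : Commute (p * q - q * p) r := by
  induction p using Polynomial.induction_on' with
  | add p p' hp hp' =>
    rw [show (p + p') * q - q * (p + p') = (p * q - q * p) + (p' * q - q * p') by noncomm_ring]
    exact hp.add_left hp'
  | monomial i a =>
    induction q using Polynomial.induction_on' with
    | add q q' hq hq' =>
      rw [mul_add, add_mul, add_sub_add_comm]
      exact hq.add_left hq'
    | monomial j b =>
      induction r using Polynomial.induction_on' with
      | add r r' hr hr' => exact hr.add_right hr'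
      | monomial l c =>
        have h := (hS a b c).eq
        simp only [Commute, SemiconjBy, monomial_mul_monomial, add_comm j i, ← map_sub,
          add_comm l, h]

theorem natDegree_mul_apply_le {A B : Matrix (Fin n) (Fin n) S[X]} {d e : ℕ}
    (hA : ∀ i j, (A i j).natDegree ≤ d) (hB : ∀ i j, (B i j).natDegree ≤ e) (i j : Fin n) :
    ((A * B) i j).natDegree ≤ d + e := by
  rw [Matrix.mul_apply]
  exact natDegree_sum_le_of_forall_le _ _ fun q _ => natDegree_mul_le_of_le (hA i q) (hB q j)

theorem natDegree_sdet_le {A : Matrix (Fin n) (Fin n) S[X]} {d : ℕ}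
    (hA : ∀ i j, (A i j).natDegree ≤ d) : (sdet A).natDegree ≤ n * d := by
  refine natDegree_sum_le_of_forall_le _ _ fun α _ =>
    natDegree_sum_le_of_forall_le _ _ fun β _ => (natDegree_smul_le _ _).trans <|
      (natDegree_list_prod_le _).trans ?_
  refine (List.sum_le_card_nsmul _ d ?_).trans (by simp)
  simp only [List.map_ofFn, List.mem_ofFn]
  rintro _ ⟨i, rfl⟩
  exact hA _ _

theorem natDegree_sadj_apply_le {A : Matrix (Fin (n + 1)) (Fin (n + 1)) S[X]} {d : ℕ}
    (hA : ∀ i j, (A i j).natDegree ≤ d) (i j : Fin (n + 1)) :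
    (sadj A i j).natDegree ≤ n * d := by
  have h := natDegree_sdet_le (A := A.submatrix j.succAbove i.succAbove) fun _ _ => hA _ _
  rw [sadj]
  rcases neg_one_pow_eq_or S[X] ((i : ℕ) + j) with h' | h' <;> simpa [h'] using h

theorem natDegree_radjProd_two_apply_le {A : Matrix (Fin (n + 1)) (Fin (n + 1)) S[X]}
    (hA : ∀ i j, (A i j).natDegree ≤ 1) (i j : Fin (n + 1)) :
    (radjProd A 2 i j).natDegree ≤ n + n * (1 + n) := by
  have hadj : ∀ i j, (sadj A i j).natDegree ≤ n := by
    simpa using natDegree_sadj_apply_le hA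
  simpa [radjProd, adjAux] using
    natDegree_mul_apply_le hadj (natDegree_sadj_apply_le (natDegree_mul_apply_le hA hadj)) i j

theorem sum_range_pow_mul_coeff_smul_one {A : Matrix (Fin n) (Fin n) S}
    {Q : Matrix (Fin n) (Fin n) S[X]} {p : S[X]}
    (h : ((X : S[X]) • (1 : Matrix (Fin n) (Fin n) S[X]) - A.map C) * Q = p • 1) (m : ℕ) :
    ∑ i ∈ Finset.range (m + 1), A ^ i * (p.coeff i • (1 : Matrix (Fin n) (Fin n) S)) =
      -(A ^ (m + 1) * Q.map (coeff · m)) := by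
  rw [sub_mul, Matrix.smul_mul, one_mul] at h
  have hcoeff : ∀ i r s, (p.coeff i • (1 : Matrix (Fin n) (Fin n) S)) r s =
      (X * Q r s).coeff i - (A * Q.map (coeff · i)) r s := by
    intro i r s
    have := congrArg (coeff · i) (congrFun (congrFun h r) s)
    simp only [Matrix.sub_apply, Matrix.smul_apply,
      Matrix.mul_apply, Matrix.map_apply, smul_eq_mul, coeff_sub, finsetSum_coeff,
      coeff_C_mul] at this ⊢
    rw [this, Matrix.one_apply, Matrix.one_apply]
    split_ifs <;> simp
  induction m with
  | zero =>
    ext r s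
    simp [hcoeff 0 r s, -Matrix.smul_apply]
  | succ m ih =>
    have hsucc : p.coeff (m + 1) • (1 : Matrix (Fin n) (Fin n) S) =
        Q.map (coeff · m) - A * Q.map (coeff · (m + 1)) := by
      ext r s
      simp [hcoeff (m + 1) r s, -Matrix.smul_apply]
    rw [Finset.sum_range_succ, ih, hsucc, mul_sub, ← mul_assoc, ← pow_succ]
    abel

/-- The right Cayley–Hamilton theorem for rings with central commutators. -/
theorem sum_pow_mul_rcharpoly_two_coeff (hS : ∀ a b c : S, Commute (a * b - b * a) c)
    (hn : IsUnit ((n + 1 : ℕ) : S)) (A : Matrix (Fin (n + 1)) (Fin (n + 1)) S) :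
    ∑ i ∈ Finset.range ((n + 1) ^ 2 + 1),
      A ^ i * ((rcharpoly A 2).coeff i • (1 : Matrix (Fin (n + 1)) (Fin (n + 1)) S)) = 0 := by
  set B := (X : S[X]) • (1 : Matrix (Fin (n + 1)) (Fin (n + 1)) S[X]) - A.map C with hB
  have hdeg : ∀ i j, (B i j).natDegree ≤ 1 := by
    intro i j
    refine (natDegree_sub_le _ _).trans (max_le ?_ ((natDegree_C _).trans_le zero_le_one))
    simp only [Matrix.smul_apply, Matrix.one_apply]
    split_ifs <;> simp [natDegree_X_le]
  have hn' : IsUnit ((n + 1 : ℕ) : S[X]) := by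
    simpa using hn.map (C : S →+* S[X])
  have h := nsmul_mul_radjProd_two (Polynomial.commute_commutator hS) hn' B
  rw [← mul_smul_comm] at h
  rw [rcharpoly, sum_range_pow_mul_coeff_smul_one h]
  have hzero : ((n + 1) • radjProd B 2).map (coeff · ((n + 1) ^ 2)) = 0 := by
    ext i j
    change ((n + 1) • radjProd B 2 i j).coeff _ = 0
    refine coeff_eq_zero_of_natDegree_lt (((natDegree_smul_le _ _).trans
      (natDegree_radjProd_two_apply_le hdeg i j)).trans_lt ?_)
    nlinarith
  rw [hzero, mul_zero, neg_zero]

end CharacteristicPolynomial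

/-- **Power Cayley–Hamilton identity for Lie nilpotent rings.** Let `R` be Lie nilpotent
of index `k ≥ 2` with `1/n ∈ R`, let `A` be an `n×n` matrix over `R` (`n ≥ 1`), let
`D = R[[R,R],R]R`, and let `Ā` be the image of `A` over `R/D`. If `λ₀,…,λ_{n²} ∈ R` have
as images in `R/D` the corresponding coefficients of the second right characteristic
polynomial `p_{Ā,2}(x)`, then `(Iₙλ₀ + Aλ₁ + ⋯ + A^(n²)λ_{n²})^(2^(k−2)) = 0`. -/
theorem power_cayleyHamilton_of_lieNilpotent
    (k n : ℕ) (hk : 2 ≤ k) (R : Type*) [Ring R] (hn : IsUnit ((n + 1 : ℕ) : R))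
    (hL : LieNilpotentOfIndex R k)
    (A : Matrix (Fin (n + 1)) (Fin (n + 1)) R)
    (D : TwoSidedIdeal R)
    (hD : D = TwoSidedIdeal.span
      {u | ∃ a b c : R, u = (a * b - b * a) * c - c * (a * b - b * a)})
    (lam : ℕ → R)
    (hlam : ∀ i, i ≤ (n + 1) ^ 2 →
      D.ringCon.mk' (lam i) = (rcharpoly (A.map D.ringCon.mk') 2).coeff i) :
    (∑ i ∈ Finset.range ((n + 1) ^ 2 + 1),
      A ^ i * (lam i • (1 : Matrix (Fin (n + 1)) (Fin (n + 1)) R))) ^ 2 ^ (k - 2) = 0 := by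

  have hD' : D = TwoSidedIdeal.span (lieCommutators R 2) := by
    rw [hD]
    congr 1
    ext u
    constructor
    · rintro ⟨a, b, c, rfl⟩
      exact ⟨_, ⟨a, Set.mem_univ a, b, rfl⟩, c, rfl⟩
    · rintro ⟨_, ⟨a, -, b, rfl⟩, c, rfl⟩
      exact ⟨a, b, c, rfl⟩
  have hcomm : ∀ a b c : D.ringCon.Quotient, Commute (a * b - b * a) c := by
    intro a b c
    obtain ⟨a, rfl⟩ := D.ringCon.mk'_surjective a
    obtain ⟨b, rfl⟩ := D.ringCon.mk'_surjective b
    obtain ⟨c, rfl⟩ := D.ringCon.mk'_surjective c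
    simp only [Commute, SemiconjBy, ← map_mul, ← map_sub]
    refine (RingCon.eq _).2 ((TwoSidedIdeal.rel_iff _ _ _).2 ?_)
    rw [hD]
    exact TwoSidedIdeal.subset_span ⟨a, b, c, rfl⟩
  have hunit : IsUnit ((n + 1 : ℕ) : D.ringCon.Quotient) := by
    simpa using hn.map D.ringCon.mk'
  set M := ∑ i ∈ Finset.range ((n + 1) ^ 2 + 1),
    A ^ i * (lam i • (1 : Matrix (Fin (n + 1)) (Fin (n + 1)) R)) with hM
  have hmap : D.ringCon.mk'.mapMatrix M = 0 := by
    rw [← sum_pow_mul_rcharpoly_two_coeff hcomm hunit (A.map D.ringCon.mk'), hM, map_sum]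
    refine Finset.sum_congr rfl fun i hi => ?_
    rw [map_mul, map_pow, ← hlam i (Nat.lt_succ_iff.1 (Finset.mem_range.1 hi))]
    congr 1
    ext r s
    simp only [RingHom.mapMatrix_apply, Matrix.map_apply, Matrix.smul_apply, Matrix.one_apply]
    split_ifs <;> simp
  have hmem : ∀ i j, M i j ∈ TwoSidedIdeal.span (lieCommutators R 2) := by
    intro i j
    rw [← hD', TwoSidedIdeal.mem_iff]
    exact (RingCon.eq _).1 (congrFun (congrFun hmap i) j)
  have hle : k - 1 ≤ 2 ^ (k - 2) := by
    have := Nat.lt_two_pow_self (n := k - 2)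
    omega
  exact pow_eq_zero_of_le hle (pow_eq_zero_of_lieNilpotent hk hL hmem)
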